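/- arXiv:2503.14596 — 2 statements merged into one kernel-verified Lean document; each statement's English description precedes it below -/
import Mathlib

section
/- Let a ∈ ℝ be nonzero. Suppose γ : L²(ℝ) → L²(ℝ) is a unitary operator (linear isometric bijection, with respect to Lebesgue measure) such that for every w ∈ ℝ and every g ∈ L²(ℝ): (i) γ applied to the L²-class of y ↦ exp(i·a·w·y) · g(y) equals the L²-class of y ↦ (γ g)(y − w), and (ii) γ applied to the L²-class of y ↦ g(w + y) equals the L²-class of y ↦ exp(i·a·w·y) · (γ g)(y). Then there exists ξ ∈ ℂ with |ξ| = 1 such that for every f ∈ L¹(ℝ) ∩ L²(ℝ), the function (γ f) agrees Lebesgue-almost everywhere with x ↦ ξ · √(|a| / (2π)) · ∫_ℝ f(y) · exp(−i·a·x·y) dy. -/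
open MeasureTheory Complex Real
open FourierTransform
open scoped Convolution ComplexConjugate

/-- **Fourier inversion formula**, almost everywhere version. -/
theorem fourierInv_fourier_ae_eq {ψ : ℝ → ℂ} (hψ : Integrable ψ) (hψ' : Integrable (𝓕 ψ)) :
    𝓕⁻ (𝓕 ψ) =ᵐ[volume] ψ := by
  have hcont : Continuous (𝓕⁻ (𝓕 ψ)) := by
    have : Continuous (𝓕 (𝓕 ψ)) :=
      VectorFourier.fourierIntegral_continuous Real.continuous_fourierChar
        (by exact continuous_inner) hψ'
    have h2 : 𝓕⁻ (𝓕 ψ) = fun x => 𝓕 (𝓕 ψ) (-x) := by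
      ext x; rw [Real.fourierInv_eq_fourier_neg]
    rw [h2]; fun_prop
  refine ae_eq_of_integral_contDiff_smul_eq hcont.locallyIntegrable hψ.locallyIntegrable ?_
  intro g hg hgs
  have hG : ContDiff ℝ (⊤ : ℕ∞) (fun x => (g x : ℂ)) := Complex.ofRealCLM.contDiff.comp hg
  have hGs : HasCompactSupport (fun x => (g x : ℂ)) :=
    hgs.comp_left (g := fun x : ℝ => (x : ℂ)) (by simp)
  let G : SchwartzMap ℝ ℂ := hGs.toSchwartzMap hG
  have hGv : ∀ x, G x = g x := fun x => rfl
  let H : SchwartzMap ℝ ℂ := 𝓕⁻ G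
  have hH : 𝓕 (H : ℝ → ℂ) = G := by
    rw [← SchwartzMap.fourier_coe, FourierTransform.fourier_fourierInv_eq]
  have hH' : (H : ℝ → ℂ) = 𝓕⁻ (G : ℝ → ℂ) := SchwartzMap.fourierInv_coe G
  have e1 : ∫ x, 𝓕 (H : ℝ → ℂ) x • ψ x = ∫ x, H x • 𝓕 ψ x := by
    have := VectorFourier.integral_fourierIntegral_smul_eq_flip (L := innerₗ ℝ) (μ := volume)
      (ν := volume) Real.continuous_fourierChar (by exact continuous_inner) H.integrable hψ
    rwa [flip_innerₗ] at this
  have e2 : ∫ x, 𝓕⁻ (G : ℝ → ℂ) x • 𝓕 ψ x = ∫ x, G x • 𝓕⁻ (𝓕 ψ) x := by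
    have := VectorFourier.integral_fourierIntegral_smul_eq_flip (L := -innerₗ ℝ) (μ := volume)
      (ν := volume) Real.continuous_fourierChar
      (by exact (continuous_inner (𝕜 := ℝ) (E := ℝ)).neg) G.integrable hψ'
    have hf : (-innerₗ ℝ).flip = -innerₗ ℝ := by
      ext; simp
    rwa [hf] at this
  rw [hH] at e1
  rw [hH', e2] at e1
  simpa [hGv] using e1.symm

/-- A measurable function that is a.e. invariant under every translation is a.e. constant. -/
theorem ae_eq_const_of_forall_ae_sub_eq {m : ℝ → ℂ} (hm : Measurable m)
    (h : ∀ w : ℝ, ∀ᵐ y, m (y - w) = m y) : ∃ c : ℂ, ∀ᵐ y, m y = c := by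
  have h1 : ∀ᵐ y : ℝ, ∀ᵐ w : ℝ, m (y - w) = m y := by
    refine (Measure.ae_ae_comm ?_).1 (Filter.Eventually.of_forall h)
    exact measurableSet_eq_fun (by fun_prop) (by fun_prop)
  obtain ⟨y, hy⟩ := h1.exists
  refine ⟨m y, ?_⟩
  have := (quasiMeasurePreserving_sub_left volume y).ae hy
  simpa using this

theorem fourier_conj_neg (f : ℝ → ℂ) (ξ : ℝ) :
    𝓕 (fun t => conj (f (-t))) ξ = conj (𝓕 f ξ) := by
  rw [Real.fourier_real_eq_integral_exp_smul, Real.fourier_real_eq_integral_exp_smul,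
    ← integral_conj, ← integral_neg_eq_self]
  congr 1 with y
  simp [← Complex.exp_conj, Complex.conj_ofNat]

theorem fourierInv_comp_neg_div {C : ℝ → ℂ} {s : ℝ} (hs : s ≠ 0) (x : ℝ) :
    𝓕⁻ (fun v => C (-v / s)) x = |s| * 𝓕 C (s * x) := by
  rw [Real.fourierInv_eq', Real.fourier_real_eq_integral_exp_smul]
  have := Measure.integral_comp_mul_left
    (fun u : ℝ => cexp (↑(-2 * π * u * (s * x)) * I) • C u) (-s⁻¹)
  have h2 : |(-s⁻¹)⁻¹| = |s| := by simp
  rw [h2] at this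
  rw [← Complex.real_smul, ← this]
  congr 1 with v
  have e : -v / s = -s⁻¹ * v := by field_simp
  rw [e]
  congr 4
  rw [RCLike.inner_apply, conj_trivial]
  field_simp

theorem integral_mul_exp_eq_fourier (a : ℝ) (f : ℝ → ℂ) (x : ℝ) :
    ∫ y : ℝ, f y * cexp (-(I * a * x * y)) = 𝓕 f (a / (2 * π) * x) := by
  rw [Real.fourier_real_eq_integral_exp_smul]
  congr 1 with y
  rw [smul_eq_mul, mul_comm]
  congr 2
  push_cast
  have : (π : ℂ) ≠ 0 := by exact_mod_cast Real.pi_ne_zero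
  field_simp

theorem convolution_conj_neg_eq (f g : ℝ → ℂ) (w : ℝ) :
    ((fun t => conj (f (-t))) ⋆[ContinuousLinearMap.mul ℂ ℂ] g) w
      = ∫ y, conj (f y) * g (w + y) := by
  rw [convolution_def, ← integral_neg_eq_self]
  simp

/-- A linear isometry of `L²(ℝ)` intertwining translations with modulations satisfies
`conj (γ f) * γ g = |s| * conj (𝓕 f (s ·)) * 𝓕 g (s ·)` almost everywhere for `f, g ∈ L¹ ∩ L²`,
where `s = a / (2 * π)`. -/
theorem conj_mul_map_ae_eq {a : ℝ} (ha : a ≠ 0)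
    (γ : Lp ℂ 2 (volume : Measure ℝ) →ₗᵢ[ℂ] Lp ℂ 2 (volume : Measure ℝ))
    (htrans : ∀ (w : ℝ) (g g' : Lp ℂ 2 (volume : Measure ℝ)),
      (⇑g' =ᵐ[volume] fun y => g (w + y)) →
      (⇑(γ g') =ᵐ[volume] fun y => cexp (I * a * w * y) * (γ g) y))
    (f g : Lp ℂ 2 (volume : Measure ℝ)) (hf : Integrable f) (hg : Integrable g) :
    ∀ᵐ x, conj (γ f x) * γ g x =
      |a / (2 * π)| * (conj (𝓕 (f : ℝ → ℂ) (a / (2 * π) * x)) *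
        𝓕 (g : ℝ → ℂ) (a / (2 * π) * x)) := by
  set s := a / (2 * π) with hs
  have hs0 : s ≠ 0 := div_ne_zero ha (by positivity)
  set C : ℝ → ℂ := (fun t => conj (f (-t))) ⋆[ContinuousLinearMap.mul ℂ ℂ] g with hC
  set ψ : ℝ → ℂ := fun x => conj (γ f x) * γ g x with hψdef
  have hfn : Integrable (fun t => conj (f (-t))) :=
    (LinearIsometryEquiv.integrable_comp_iff (L := Complex.conjLIE)
      (φ := fun t => f (-t))).2 hf.comp_neg
  have hCint : Integrable C := hfn.integrable_convolution _ hg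
  have hψ : Integrable ψ := by
    have := L2.integrable_inner (𝕜 := ℂ) (γ f) (γ g)
    refine this.congr (Filter.Eventually.of_forall fun x => ?_)
    simp [hψdef, RCLike.inner_apply, mul_comm]
  have hcorr : ∀ w : ℝ, ∫ x : ℝ, cexp (I * a * w * x) * ψ x = C w := by
    intro w
    have hmem : MemLp (fun y => g (w + y)) 2 volume :=
      (Lp.memLp g).comp_measurePreserving (measurePreserving_add_left volume w)
    have h1 := htrans w g _ hmem.coeFn_toLp
    have h2 := γ.inner_map_map f hmem.toLp
    rw [L2.inner_def, L2.inner_def] at h2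
    rw [hC, convolution_conj_neg_eq]
    calc _ = ∫ x, inner ℂ (γ f x) (γ hmem.toLp x) := by
          refine integral_congr_ae ?_
          filter_upwards [h1] with x hx
          rw [hx, RCLike.inner_apply]
          simp only [hψdef]; ring
      _ = _ := by
          rw [h2]
          refine integral_congr_ae ?_
          filter_upwards [hmem.coeFn_toLp] with x hx
          rw [hx, RCLike.inner_apply, mul_comm]
  have hF : 𝓕 ψ = fun v => C (-v / s) := by
    ext v
    rw [← hcorr, Real.fourier_real_eq_integral_exp_smul]
    refine integral_congr_ae (Filter.Eventually.of_forall fun x => ?_)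
    simp only [smul_eq_mul]
    congr 2
    rw [hs]
    push_cast
    have : (π : ℂ) ≠ 0 := by exact_mod_cast Real.pi_ne_zero
    have : (a : ℂ) ≠ 0 := by exact_mod_cast ha
    field_simp
  have hFint : Integrable (𝓕 ψ) := by
    rw [hF]
    have := hCint.comp_mul_left' (R := -s⁻¹) (by simpa using hs0)
    refine this.congr (Filter.Eventually.of_forall fun x => ?_)
    simp only
    congr 1
    field_simp
  filter_upwards [fourierInv_fourier_ae_eq hψ hFint] with x hx
  change ψ x = _
  rw [← hx, hF, fourierInv_comp_neg_div hs0, hC, Real.fourier_mul_convolution_eq hfn hg,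
    fourier_conj_neg]

theorem norm_exp_I_mul (a w y : ℝ) : ‖cexp (I * a * w * y)‖ = 1 := by
  have : I * a * w * y = ((a * w * y : ℝ) : ℂ) * I := by push_cast; ring
  rw [this, Complex.norm_exp_ofReal_mul_I]

/-- There is an `L¹ ∩ L²` function whose Fourier transform is continuous and vanishes nowhere. -/
theorem exists_integrable_fourier_ne_zero :
    ∃ g : Lp ℂ 2 (volume : Measure ℝ), Integrable g ∧ Continuous (𝓕 (g : ℝ → ℂ)) ∧
      ∀ t, 𝓕 (g : ℝ → ℂ) t ≠ 0 := by
  let G : ℝ → ℂ := fun x => cexp (-π * 1 * x ^ 2)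
  have hG : Integrable G := by
    have := integrable_cexp_neg_mul_sq (b := π) (by simpa using Real.pi_pos)
    simpa [G] using this
  have hG2 : MemLp G 2 := by
    rw [memLp_two_iff_integrable_sq_norm hG.aestronglyMeasurable]
    have := integrable_exp_neg_mul_sq (b := 2 * π) (by positivity)
    refine this.congr (Filter.Eventually.of_forall fun x => ?_)
    simp only [G, Complex.norm_exp, ← Real.exp_nat_mul]
    congr 1
    simp [← Complex.ofReal_pow]
    ring
  have h : 𝓕 (hG2.toLp : ℝ → ℂ) = 𝓕 G := by
    ext t
    rw [Real.fourier_real_eq_integral_exp_smul, Real.fourier_real_eq_integral_exp_smul]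
    refine integral_congr_ae ?_
    filter_upwards [hG2.coeFn_toLp] with x hx
    rw [hx]
  refine ⟨hG2.toLp, hG.congr hG2.coeFn_toLp.symm, ?_, fun t => ?_⟩
  · rw [h, fourier_gaussian_pi (by simp)]
    fun_prop
  · rw [h, fourier_gaussian_pi (by simp)]
    simp

/-- **Theorem A.5 for `G = ℝ`.** Let `a ≠ 0` and let `γ` be a unitary operator on `L²(ℝ)`
intertwining modulation by `exp(i a w ·)` with translation by `w`, and translation by `w` with
modulation by `exp(i a w ·)`, for every `w ∈ ℝ`. Then there is a unimodular constant `ξ` such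
that for every `f ∈ L¹(ℝ) ∩ L²(ℝ)`, `γ f` agrees almost everywhere with
`x ↦ ξ · √(|a|/(2π)) · ∫ f(y) exp(−i a x y) dy`. -/
theorem stmt3
    (a : ℝ) (ha : a ≠ 0)
    (γ : Lp ℂ 2 (volume : Measure ℝ) ≃ₗᵢ[ℂ] Lp ℂ 2 (volume : Measure ℝ))
    (hmod : ∀ (w : ℝ) (g g' : Lp ℂ 2 (volume : Measure ℝ)),
      (⇑g' =ᵐ[volume] fun y => Complex.exp (Complex.I * a * w * y) * g y) →
      (⇑(γ g') =ᵐ[volume] fun y => (γ g) (y - w)))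
    (htrans : ∀ (w : ℝ) (g g' : Lp ℂ 2 (volume : Measure ℝ)),
      (⇑g' =ᵐ[volume] fun y => g (w + y)) →
      (⇑(γ g') =ᵐ[volume] fun y => Complex.exp (Complex.I * a * w * y) * (γ g) y)) :
    ∃ ξ : ℂ, ‖ξ‖ = 1 ∧
      ∀ f : Lp ℂ 2 (volume : Measure ℝ), Integrable (⇑f) volume →
        (⇑(γ f) =ᵐ[volume] fun x =>
          ξ * (Real.sqrt (|a| / (2 * Real.pi)) : ℂ) *
            ∫ y : ℝ, f y * Complex.exp (-(Complex.I * a * x * y))) := by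
  obtain ⟨g, hg, hgc, hg0⟩ := exists_integrable_fourier_ne_zero
  have hs : |a / (2 * π)| = |a| / (2 * π) := by
    rw [abs_div, abs_of_pos (by positivity : (0 : ℝ) < 2 * π)]
  have hspos : 0 < |a| / (2 * π) := by positivity
  have key := fun f hf => conj_mul_map_ae_eq ha γ.toLinearIsometry htrans g f hg hf
  simp only [hs, LinearIsometryEquiv.coe_toLinearIsometry] at key
  simp only [integral_mul_exp_eq_fourier]
  set s := a / (2 * π) with hsdef
  set r := |a| / (2 * π) with hr
  have hr0 : (r : ℂ) ≠ 0 := by exact_mod_cast hspos.ne'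
  have hc0 : (√r : ℂ) ≠ 0 := by exact_mod_cast (Real.sqrt_pos.2 hspos).ne'
  set m : ℝ → ℂ := fun x => γ g x / (√r * 𝓕 (g : ℝ → ℂ) (s * x)) with hm
  have hmmeas : Measurable m :=
    (Lp.stronglyMeasurable (γ g)).measurable.div (by fun_prop)
  have hγ : ∀ f : Lp ℂ 2 (volume : Measure ℝ), Integrable f →
      ∀ᵐ x, γ f x = m x * √r * 𝓕 (f : ℝ → ℂ) (s * x) := by
    intro f hf
    filter_upwards [key f hf, key g hg] with x h1 h2
    have hP := hg0 (s * x)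
    have hP' : conj (𝓕 (g : ℝ → ℂ) (s * x)) ≠ 0 := by simpa using hP
    simp only [hm]
    field_simp
    refine mul_left_cancel₀ (mul_ne_zero hr0 hP') ?_
    linear_combination (-γ f x) * h2 + γ g x * h1
  have hnorm : ∀ᵐ x, ‖m x‖ = 1 := by
    filter_upwards [key g hg] with x h2
    have hP := hg0 (s * x)
    rw [Complex.conj_mul', Complex.conj_mul'] at h2
    have h3 : ‖γ g x‖ ^ 2 = r * ‖𝓕 (g : ℝ → ℂ) (s * x)‖ ^ 2 := by exact_mod_cast h2
    have h4 : ‖γ g x‖ = √r * ‖𝓕 (g : ℝ → ℂ) (s * x)‖ := by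
      rw [← Real.sqrt_sq (norm_nonneg (γ g x)), h3, Real.sqrt_mul hspos.le,
        Real.sqrt_sq (norm_nonneg _)]
    simp only [hm]
    rw [norm_div, norm_mul, h4, Complex.norm_real, Real.norm_of_nonneg (Real.sqrt_nonneg r)]
    exact div_self (mul_ne_zero (Real.sqrt_pos.2 hspos).ne' (norm_ne_zero_iff.2 hP))
  have hinv : ∀ w : ℝ, ∀ᵐ y, m (y - w) = m y := by
    intro w
    have hmeas : AEStronglyMeasurable (fun y : ℝ => cexp (I * a * w * y) * g y) :=
      (by fun_prop : Continuous fun y : ℝ => cexp (I * a * w * y)).aestronglyMeasurable.mul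
        (Lp.aestronglyMeasurable g)
    have hle : ∀ᵐ y : ℝ, ‖cexp (I * a * w * y) * g y‖ ≤ ‖g y‖ :=
      Filter.Eventually.of_forall fun y => by simp [norm_exp_I_mul]
    have hmem : MemLp (fun y : ℝ => cexp (I * a * w * y) * g y) 2 volume :=
      (Lp.memLp g).of_le hmeas hle
    have hint : Integrable hmem.toLp := (hg.mono hmeas hle).congr hmem.coeFn_toLp.symm
    have hF : ∀ y, 𝓕 (hmem.toLp : ℝ → ℂ) (s * y) = 𝓕 (g : ℝ → ℂ) (s * (y - w)) := by
      intro y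
      rw [← integral_mul_exp_eq_fourier, ← integral_mul_exp_eq_fourier]
      refine integral_congr_ae ?_
      filter_upwards [hmem.coeFn_toLp] with z hz
      rw [hz, mul_right_comm, ← Complex.exp_add, mul_comm]
      congr 2
      push_cast
      ring
    filter_upwards [hmod w g _ hmem.coeFn_toLp, hγ _ hint] with y h1 h2
    have hP := hg0 (s * (y - w))
    rw [h1, hF] at h2
    simp only [hm] at h2 ⊢
    rw [h2]
    field_simp
  obtain ⟨ξ, hξ⟩ := ae_eq_const_of_forall_ae_sub_eq hmmeas hinv
  refine ⟨ξ, ?_, fun f hf => ?_⟩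
  · obtain ⟨x, h1, h2⟩ := (hξ.and hnorm).exists
    rw [← h1, h2]
  · filter_upwards [hγ f hf, hξ] with x h1 h2
    rw [h1, h2]
end

section
/- Let χ : ℝ × ℝ → Circle be a continuous map which is additive in each variable (χ(x + x', y) = χ(x, y) * χ(x', y) and χ(x, y + y') = χ(x, y) * χ(x, y') for all x, x', y, y' ∈ ℝ) and symmetric (χ(x, y) = χ(y, x) for all x, y). Then there exists a unique a ∈ ℝ such that χ(x, y) = exp(i·a·x·y) for all x, y ∈ ℝ. Moreover, χ is nondegenerate, in the sense that the only y ∈ ℝ with χ(x, y) = 1 for all x ∈ ℝ is y = 0, if and only if a ≠ 0. -/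
open Complex in
/-- A continuous map `ℝ → ℂ` turning addition into multiplication and not vanishing at `0` is an
exponential. -/
theorem exists_eq_exp_mul_of_continuous_of_map_add {f : ℝ → ℂ} (hf : Continuous f)
    (h0 : f 0 = 1) (hadd : ∀ x y, f (x + y) = f x * f y) :
    ∃ k : ℂ, ∀ x : ℝ, f x = exp (k * x) := by
  have hF : ∀ x, HasDerivAt (fun t : ℝ => ∫ s in (0 : ℝ)..t, f s) (f x) x := fun x =>
    intervalIntegral.integral_hasDerivAt_right (hf.intervalIntegrable _ _)
      (hf.stronglyMeasurableAtFilter _ _) hf.continuousAt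
  set F : ℝ → ℂ := fun t => ∫ s in (0 : ℝ)..t, f s with hFdef
  obtain ⟨c, hc⟩ : ∃ c, F c ≠ 0 := by
    by_contra! h
    have h1 := hF 0
    rw [show F = fun _ => 0 from funext h, h0] at h1
    exact one_ne_zero (h1.unique (hasDerivAt_const _ _))
  have hfF : ∀ x, f x = (F (x + c) - F x) / F c := by
    intro x
    rw [eq_div_iff hc]
    simp only [hFdef]
    rw [intervalIntegral.integral_interval_sub_left (hf.intervalIntegrable _ _)
      (hf.intervalIntegrable _ _), ← intervalIntegral.integral_const_mul]
    simp_rw [← hadd]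
    rw [intervalIntegral.integral_comp_add_left (fun s => f s), add_zero]
  have hderiv : ∀ x, HasDerivAt f ((f c - 1) / F c * f x) x := by
    intro x
    have h := (((hF (x + c)).comp_add_const x c).sub (hF x)).div_const (F c)
    rw [hadd] at h
    rw [show (f c - 1) / F c * f x = (f x * f c - f x) / F c by ring]
    exact h.congr_of_eventuallyEq (.of_forall hfF)
  set k := (f c - 1) / F c
  have hexp : ∀ x : ℝ, HasDerivAt (fun t : ℝ => exp (-(k * t))) (exp (-(k * x)) * -(k * 1)) x :=
    fun x => ((Complex.ofRealCLM.hasDerivAt.const_mul k).neg).cexp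
  refine ⟨k, fun x => ?_⟩
  have hprod (t : ℝ) : HasDerivAt (fun t : ℝ => f t * exp (-(k * t))) 0 t :=
    ((hderiv t).mul (hexp t)).congr_deriv (by ring)
  have hconst := is_const_of_deriv_eq_zero (fun t => (hprod t).differentiableAt)
    (fun t => (hprod t).deriv) x 0
  simp only [h0, ofReal_zero, mul_zero, neg_zero, exp_zero, mul_one] at hconst
  rw [exp_neg] at hconst
  exact (mul_inv_eq_one₀ (exp_ne_zero _)).1 hconst

/-- A real frequency is determined by its unitary character. -/
theorem eq_of_forall_exp_I_mul_eq {a b : ℝ}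
    (h : ∀ x : ℝ, Complex.exp (Complex.I * a * x) = Complex.exp (Complex.I * b * x)) : a = b := by
  have hd (c : ℝ) : HasDerivAt (fun x : ℝ => Complex.exp (Complex.I * c * x)) (Complex.I * c) 0 := by
    simpa using ((Complex.ofRealCLM.hasDerivAt (x := 0)).const_mul (Complex.I * c)).cexp
  have ha := hd a
  rw [funext h] at ha
  exact_mod_cast mul_left_cancel₀ Complex.I_ne_zero (ha.unique (hd b))

/-- Every continuous character of `ℝ` is `x ↦ exp(i a x)` for some real `a`. -/
theorem exists_eq_exp_I_mul_of_continuous_of_map_add {f : ℝ → Circle} (hf : Continuous f)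
    (hadd : ∀ x y, f (x + y) = f x * f y) :
    ∃ a : ℝ, ∀ x : ℝ, (f x : ℂ) = Complex.exp (Complex.I * a * x) := by
  have h0 : f 0 = 1 := by simpa using hadd 0 0
  obtain ⟨k, hk⟩ := exists_eq_exp_mul_of_continuous_of_map_add
    (f := fun x => (f x : ℂ)) (by fun_prop) (by simp [h0]) (fun x y => by simp [hadd])
  have hre : k.re = 0 := by
    have h := congrArg norm (hk 1)
    rw [Circle.norm_coe, Complex.norm_exp, eq_comm, Real.exp_eq_one_iff] at h
    simpa using h
  have hkI : k = Complex.I * k.im := by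
    apply Complex.ext <;> simp [hre]
  exact ⟨k.im, fun x => by rw [← hkI, hk]⟩


/-- **Classification of continuous symmetric bicharacters on `ℝ`.** Every continuous symmetric
bicharacter `χ : ℝ × ℝ → Circle` is of the form `χ(x, y) = exp(i a x y)` for a unique `a ∈ ℝ`,
and `χ` is nondegenerate precisely when `a ≠ 0`. -/
theorem stmt4
    (χ : ℝ × ℝ → Circle) (hχcont : Continuous χ)
    (hadd₁ : ∀ x x' y : ℝ, χ (x + x', y) = χ (x, y) * χ (x', y))
    (hadd₂ : ∀ x y y' : ℝ, χ (x, y + y') = χ (x, y) * χ (x, y'))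
    (hsymm : ∀ x y : ℝ, χ (x, y) = χ (y, x)) :
    (∃! a : ℝ, ∀ x y : ℝ, (χ (x, y) : ℂ) = Complex.exp (Complex.I * a * x * y)) ∧
    ∀ a : ℝ, (∀ x y : ℝ, (χ (x, y) : ℂ) = Complex.exp (Complex.I * a * x * y)) →
      ((∀ y : ℝ, (∀ x : ℝ, χ (x, y) = 1) → y = 0) ↔ a ≠ 0) := by
  have hchar (y : ℝ) := exists_eq_exp_I_mul_of_continuous_of_map_add
    (f := fun x => χ (x, y)) (by fun_prop) (fun x x' => hadd₁ x x' y)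
  choose a ha using hchar
  have ha_add (y y' : ℝ) : a (y + y') = a y + a y' := by
    refine eq_of_forall_exp_I_mul_eq fun x => ?_
    rw [← ha, hadd₂, Circle.coe_mul, ha, ha, ← Complex.exp_add]
    push_cast
    ring_nf
  have ha_rat (q : ℚ) : a q = q * a 1 := by
    simpa [Rat.smul_def] using map_rat_smul (AddMonoidHom.mk' a ha_add) q (1 : ℝ)
  refine ⟨⟨a 1, fun x y => ?_, fun b hb => ?_⟩, fun b hb => ⟨?_, fun hb0 y hy => ?_⟩⟩
  · have hext : (fun y : ℝ => (χ (x, y) : ℂ)) =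
        fun y : ℝ => Complex.exp (Complex.I * a 1 * x * y) := by
      refine (Rat.isDenseEmbedding_coe_real.dense).equalizer (by fun_prop) (by fun_prop) ?_
      funext q
      simp only [Function.comp_apply, ha, ha_rat]
      push_cast
      ring_nf
    exact congrFun hext y
  · refine eq_of_forall_exp_I_mul_eq fun x => ?_
    rw [← ha, hb]
    simp
  · rintro h rfl
    exact one_ne_zero (h 1 fun x => Circle.ext (by simp [hb]))
  · have hby : b * y = 0 := by
      refine eq_of_forall_exp_I_mul_eq fun x => ?_
      have h := hb x y
      rw [hy] at h
      simp only [Circle.coe_one] at h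
      simp only [Complex.ofReal_zero, mul_zero, zero_mul, Complex.exp_zero]
      rw [h]
      push_cast
      ring_nf
    exact (mul_eq_zero.1 hby).resolve_left hb0
end
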